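/- Fix k ≥ 1. Let G = (V,E) be a connected graph, let Q ⊆ V × V be a set of pairs of distinct nonadjacent vertices, and let (Ê_1, Ê_2) be a partition of a subset Ê ⊆ E into two classes, each edge e ∈ Ê having endpoints e^1, e^2. Construct G' as follows: add new vertices c, b_1, b_2 and, for each e ∈ Ê_1 ∪ Ê_2 and j ∈ {1,2}, new vertices c^j_e, d^j_e, f^j_e; add the edges b_1 c, b_2 c, the edges c c^j_e, and the edges c^j_e f^j_e, c^j_e e^j, d^j_e e^j for all e and j ∈ {1,2}. Let P = Q ∪ {{b_1,b_2}} ∪ {{b_i, c^j_e} : e ∈ Ê_i, i,j ∈ {1,2}} ∪ {{f^j_e, c}, {f^j_e, e^j}, {d^j_e, c^j_e}, {d^j_e, e^{3−j}} : j ∈ {1,2}, e ∈ Ê_1 ∪ Ê_2}. Then, for every pair {u,v} ∈ P \ Q, add k−1 further new vertices g_{(u,v,2)},…,g_{(u,v,k)}, each adjacent to both u and v. Then G' admits a total coloring with 3 colors making every pair in P total rainbow k-connected if and only if G admits a total coloring χ : V ∪ E → {0,1,2} with 3 colors making every pair in Q total rainbow k-connected such that all edges of Ê_1 receive one common color, all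 edges of Ê_2 receive another common color different from it, and χ(e) ∉ {χ(e^1), χ(e^2)} for every e ∈ Ê. -/

import Mathlib

open SimpleGraph

namespace Paper

variable {V : Type*}

/-- The internal vertices of a walk (all vertices except the two endpoints). -/
def internalSupport {G : SimpleGraph V} {u v : V} (p : G.Walk u v) : List V :=
  p.support.tail.dropLast

/-- A family of walks between two fixed vertices is internally disjoint if the walks
are pairwise distinct and no two of them share an internal vertex. -/
def InternallyDisjoint {G : SimpleGraph V} {u v : V} {k : ℕ}
    (P : Fin k → G.Walk u v) : Prop :=
  Function.Injective P ∧
    ∀ i j, i ≠ j → ∀ w, w ∈ internalSupport (P i) → w ∉ internalSupport (P j)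

/-- A rainbow path for an edge coloring: a path whose edges have pairwise distinct colors. -/
def IsRainbowPath {α : Type*} {G : SimpleGraph V} (c : Sym2 V → α)
    {u v : V} (p : G.Walk u v) : Prop :=
  p.IsPath ∧ (p.edges.map c).Nodup

/-- A vertex-rainbow path: a path whose internal vertices have pairwise distinct colors. -/
def IsVertexRainbowPath {α : Type*} {G : SimpleGraph V} (c : V → α)
    {u v : V} (p : G.Walk u v) : Prop :=
  p.IsPath ∧ ((internalSupport p).map c).Nodup

/-- A total rainbow path: a path whose edges and internal vertices all have
pairwise distinct colors. -/
def IsTotalRainbowPath {α : Type*} {G : SimpleGraph V} (cv : V → α) (ce : Sym2 V → α)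
    {u v : V} (p : G.Walk u v) : Prop :=
  p.IsPath ∧ (p.edges.map ce ++ (internalSupport p).map cv).Nodup

/-- `G` is rainbow `k`-connected under the edge coloring `c`: any two distinct vertices are
joined by `k` pairwise internally vertex-disjoint rainbow paths. -/
def RainbowKConnected {α : Type*} (G : SimpleGraph V) (c : Sym2 V → α) (k : ℕ) : Prop :=
  ∀ u v : V, u ≠ v → ∃ P : Fin k → G.Walk u v,
    (∀ i, IsRainbowPath c (P i)) ∧ InternallyDisjoint P

/-- `G` is rainbow vertex `k`-connected under the vertex coloring `c`. -/
def VertexRainbowKConnected {α : Type*} (G : SimpleGraph V) (c : V → α) (k : ℕ) : Prop :=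
  ∀ u v : V, u ≠ v → ∃ P : Fin k → G.Walk u v,
    (∀ i, IsVertexRainbowPath c (P i)) ∧ InternallyDisjoint P

/-- The pair `u, v` is total rainbow `k`-connected under the total coloring `(cv, ce)`:
`u` and `v` are joined by `k` pairwise internally vertex-disjoint total rainbow paths. -/
def TotalRainbowKConnectedPair {α : Type*} (G : SimpleGraph V)
    (cv : V → α) (ce : Sym2 V → α) (k : ℕ) (u v : V) : Prop :=
  ∃ P : Fin k → G.Walk u v,
    (∀ i, IsTotalRainbowPath cv ce (P i)) ∧ InternallyDisjoint P

/-- `G` is total rainbow `k`-connected under the total coloring `(cv, ce)`. -/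
def TotalRainbowKConnected {α : Type*} (G : SimpleGraph V)
    (cv : V → α) (ce : Sym2 V → α) (k : ℕ) : Prop :=
  ∀ u v : V, u ≠ v → TotalRainbowKConnectedPair G cv ce k u v

/-- The rainbow `k`-connection number: the least number of colors of an edge coloring
making `G` rainbow `k`-connected. -/
noncomputable def rcK (G : SimpleGraph V) (k : ℕ) : ℕ :=
  sInf {t | ∃ c : Sym2 V → Fin t, RainbowKConnected G c k}

/-- The rainbow vertex `k`-connection number. -/
noncomputable def rvcK (G : SimpleGraph V) (k : ℕ) : ℕ :=
  sInf {t | ∃ c : V → Fin t, VertexRainbowKConnected G c k}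

/-- The total rainbow `k`-connection number. -/
noncomputable def trcK (G : SimpleGraph V) (k : ℕ) : ℕ :=
  sInf {t | ∃ (cv : V → Fin t) (ce : Sym2 V → Fin t), TotalRainbowKConnected G cv ce k}

/-- `G` is `l`-connected: it has more than `l` vertices and deleting any set of fewer than
`l` vertices leaves a connected graph. -/
def IsLConnected (G : SimpleGraph V) [Fintype V] (l : ℕ) : Prop :=
  l < Fintype.card V ∧
    ∀ S : Set V, S.ncard < l → (G.induce Sᶜ).Connected

/-- The precolored edge set `Ê = Ê₁ ∪ Ê₂`, each edge recorded with its ordered endpoints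
`(e¹, e²)`. -/
abbrev EHat (V : Type*) (E1 E2 : Set (V × V)) : Type _ := {e : V × V // e ∈ E1 ∪ E2}

/-- The other superscript: `other 1 = 2` and `other 2 = 1` (with `Fin 2` coding
superscript `j+1` by `j`). -/
def Fin2.other (j : Fin 2) : Fin 2 := 1 - j

/-- The endpoint `e^{j+1}` of an ordered edge `e = (e¹, e²)`. -/
def ept {V : Type*} (e : V × V) (j : Fin 2) : V := if j = 0 then e.1 else e.2

/-- The new vertices added in the reduction of Lemma 2.3: the vertices `c, b₁, b₂`, the
vertices `c^j_e, d^j_e, f^j_e` for `e ∈ Ê` and `j ∈ {1,2}`, and, for each pair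
`{u,v} ∈ P \ Q`, the `k - 1` vertices `g_{(u,v,2)}, …, g_{(u,v,k)}` (tagged by the kind of
pair they serve). -/
inductive Gadget (V : Type*) (E1 E2 : Set (V × V)) (k : ℕ) : Type _
  | c : Gadget V E1 E2 k
  | b1 : Gadget V E1 E2 k
  | b2 : Gadget V E1 E2 k
  | cc (e : EHat V E1 E2) (j : Fin 2) : Gadget V E1 E2 k
  | dd (e : EHat V E1 E2) (j : Fin 2) : Gadget V E1 E2 k
  | ff (e : EHat V E1 E2) (j : Fin 2) : Gadget V E1 E2 k
  | gbb (t : Fin (k - 1)) : Gadget V E1 E2 k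
  | gbc (e : EHat V E1 E2) (j : Fin 2) (t : Fin (k - 1)) : Gadget V E1 E2 k
  | gfc (e : EHat V E1 E2) (j : Fin 2) (t : Fin (k - 1)) : Gadget V E1 E2 k
  | gfe (e : EHat V E1 E2) (j : Fin 2) (t : Fin (k - 1)) : Gadget V E1 E2 k
  | gdc (e : EHat V E1 E2) (j : Fin 2) (t : Fin (k - 1)) : Gadget V E1 E2 k
  | gde (e : EHat V E1 E2) (j : Fin 2) (t : Fin (k - 1)) : Gadget V E1 E2 k

/-- Adjacencies between an original vertex and a gadget vertex: `c^j_e e^j`, `d^j_e e^j`,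
and the `g`-vertices for the pairs `{f^j_e, e^j}` and `{d^j_e, e^{3-j}}`. -/
def gadgetVRel {V : Type*} {E1 E2 : Set (V × V)} {k : ℕ} (a : V) :
    Gadget V E1 E2 k → Prop
  | Gadget.cc e j => a = ept e.1 j
  | Gadget.dd e j => a = ept e.1 j
  | Gadget.gfe e j _ => a = ept e.1 j
  | Gadget.gde e j _ => a = ept e.1 (Fin2.other j)
  | _ => False

/-- Adjacencies between gadget vertices: `b₁c`, `b₂c`, `cc^j_e`, `c^j_e f^j_e`, and the
`g`-vertices for the pairs `{b₁,b₂}`, `{b_i, c^j_e}` (`e ∈ Ê_i`), `{f^j_e, c}`,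
`{f^j_e, e^j}` (the `e^j`-side is in `gadgetVRel`), `{d^j_e, c^j_e}`, `{d^j_e, e^{3-j}}`. -/
def gadgetRel {V : Type*} {E1 E2 : Set (V × V)} {k : ℕ} :
    Gadget V E1 E2 k → Gadget V E1 E2 k → Prop
  | Gadget.b1, Gadget.c => True
  | Gadget.b2, Gadget.c => True
  | Gadget.c, Gadget.cc _ _ => True
  | Gadget.cc e j, Gadget.ff e' j' => e = e' ∧ j = j'
  | Gadget.gbb _, Gadget.b1 => True
  | Gadget.gbb _, Gadget.b2 => True
  | Gadget.gbc e _ _, Gadget.b1 => e.1 ∈ E1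
  | Gadget.gbc e _ _, Gadget.b2 => e.1 ∈ E2
  | Gadget.gbc e j _, Gadget.cc e' j' => e = e' ∧ j = j'
  | Gadget.gfc e j _, Gadget.ff e' j' => e = e' ∧ j = j'
  | Gadget.gfc _ _ _, Gadget.c => True
  | Gadget.gfe e j _, Gadget.ff e' j' => e = e' ∧ j = j'
  | Gadget.gdc e j _, Gadget.dd e' j' => e = e' ∧ j = j'
  | Gadget.gdc e j _, Gadget.cc e' j' => e = e' ∧ j = j'
  | Gadget.gde e j _, Gadget.dd e' j' => e = e' ∧ j = j'
  | _, _ => False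

/-- The adjacency generating relation of the reduction graph `G'` of Lemma 2.3. -/
def gadgetBigRel {V : Type*} (G : SimpleGraph V) (E1 E2 : Set (V × V)) (k : ℕ) :
    (V ⊕ Gadget V E1 E2 k) → (V ⊕ Gadget V E1 E2 k) → Prop
  | Sum.inl a, Sum.inl b => G.Adj a b
  | Sum.inl a, Sum.inr w => gadgetVRel a w
  | Sum.inr w, Sum.inr w' => gadgetRel w w'
  | _, _ => False

/-- The reduction graph `G'` of Lemma 2.3. -/
def gadgetGraph {V : Type*} (G : SimpleGraph V) (E1 E2 : Set (V × V)) (k : ℕ) :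
    SimpleGraph (V ⊕ Gadget V E1 E2 k) :=
  SimpleGraph.fromRel (gadgetBigRel G E1 E2 k)

/-- The set of pairs `P` of Lemma 2.3:
`P = Q ∪ {{b₁,b₂}} ∪ {{b_i, c^j_e} : e ∈ Ê_i} ∪
{{f^j_e, c}, {f^j_e, e^j}, {d^j_e, c^j_e}, {d^j_e, e^{3-j}} : j ∈ {1,2}, e ∈ Ê}`. -/
def gadgetP {V : Type*} {E1 E2 : Set (V × V)} {k : ℕ} (Q : Set (Sym2 V)) :
    (V ⊕ Gadget V E1 E2 k) → (V ⊕ Gadget V E1 E2 k) → Prop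
  | Sum.inl u, Sum.inl v => s(u, v) ∈ Q
  | Sum.inr Gadget.b1, Sum.inr Gadget.b2 => True
  | Sum.inr Gadget.b1, Sum.inr (Gadget.cc e _) => e.1 ∈ E1
  | Sum.inr Gadget.b2, Sum.inr (Gadget.cc e _) => e.1 ∈ E2
  | Sum.inr (Gadget.ff _ _), Sum.inr Gadget.c => True
  | Sum.inr (Gadget.ff e j), Sum.inl a => a = ept e.1 j
  | Sum.inr (Gadget.dd e j), Sum.inr (Gadget.cc e' j') => e = e' ∧ j = j'
  | Sum.inr (Gadget.dd e j), Sum.inl a => a = ept e.1 (Fin2.other j)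
  | _, _ => False

/-- The two edges and the midpoint of the path `u w v` have pairwise distinct colors. -/
def RainbowMid {W α : Type*} (cv : W → α) (ce : Sym2 W → α) (u w v : W) : Prop :=
  ce s(u, w) ≠ ce s(w, v) ∧ ce s(u, w) ≠ cv w ∧ ce s(w, v) ≠ cv w

theorem exists_mid_of_isTotalRainbowPath {W : Type*} {H : SimpleGraph W} {cv : W → Fin 3}
    {ce : Sym2 W → Fin 3} {u v : W} (hne : u ≠ v) (hna : ¬H.Adj u v) (p : H.Walk u v)
    (hp : IsTotalRainbowPath cv ce p) :
    ∃ w, H.Adj u w ∧ H.Adj w v ∧ RainbowMid cv ce u w v ∧ w ∈ internalSupport p := by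
  obtain ⟨-, hnd⟩ := hp
  cases p with
  | nil => exact absurd rfl hne
  | cons h p =>
    cases p with
    | nil => exact absurd h hna
    | @cons _ w _ h' p =>
      cases p with
      | nil =>
        refine ⟨_, h, h', ?_, ?_⟩
        · simpa [internalSupport, RainbowMid, and_assoc] using hnd
        · simp [internalSupport]
      | cons h'' p =>
        have hlen := hnd.length_le_card
        simp [internalSupport] at hlen
        omega

theorem totalRainbowKConnectedPair_iff_exists_mid {W : Type*} {H : SimpleGraph W}
    {cv : W → Fin 3} {ce : Sym2 W → Fin 3} {k : ℕ} {u v : W} (hne : u ≠ v)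
    (hna : ¬H.Adj u v) :
    TotalRainbowKConnectedPair H cv ce k u v ↔
      ∃ m : Fin k → W, Function.Injective m ∧
        ∀ i, H.Adj u (m i) ∧ H.Adj (m i) v ∧ RainbowMid cv ce u (m i) v := by
  constructor
  · rintro ⟨P, hP, -, hdis⟩
    choose m h1 h2 h3 h4 using fun i => exists_mid_of_isTotalRainbowPath hne hna (P i) (hP i)
    refine ⟨m, fun i j hij => ?_, fun i => ⟨h1 i, h2 i, h3 i⟩⟩
    by_contra hne'
    exact hdis i j hne' _ (h4 i) (hij ▸ h4 j)
  · rintro ⟨m, hinj, hm⟩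
    refine ⟨fun i => .cons (hm i).1 (.cons (hm i).2.1 .nil), fun i => ⟨?_, ?_⟩, ?_, ?_⟩
    · simp [Walk.cons_isPath_iff, hne, (hm i).1.ne, (hm i).2.1.ne]
    · simpa [internalSupport, RainbowMid, and_assoc] using (hm i).2.2
    · intro i j hij
      have := congrArg Walk.support hij
      simp at this
      exact hinj this
    · intro i j hij w hi hj
      simp [internalSupport] at hi hj
      exact hij (hinj (hi.symm.trans hj))

theorem totalRainbowKConnectedPair_iff_of_commonNeighbors {W : Type*} {H : SimpleGraph W}
    {cv : W → Fin 3} {ce : Sym2 W → Fin 3} {n : ℕ} {u v : W} (w : W) (g : Fin n → W)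
    (hne : u ≠ v) (hna : ¬H.Adj u v) (hg : Function.Injective g) (hw : ∀ t, g t ≠ w)
    (hcom : ∀ x, H.Adj u x ∧ H.Adj x v ↔ x = w ∨ ∃ t, g t = x) :
    TotalRainbowKConnectedPair H cv ce (n + 1) u v ↔
      RainbowMid cv ce u w v ∧ ∀ t, RainbowMid cv ce u (g t) v := by
  rw [totalRainbowKConnectedPair_iff_exists_mid hne hna]
  have hinj : Function.Injective (Fin.cons w g : Fin (n + 1) → W) :=
    Fin.cons_injective_iff.2 ⟨by rintro ⟨t, ht⟩; exact hw t ht, hg⟩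
  constructor
  · rintro ⟨m, hm, h⟩
    have hmem : ∀ i, ∃ j, (Fin.cons w g : Fin (n + 1) → W) j = m i := by
      intro i
      rcases (hcom _).1 ⟨(h i).1, (h i).2.1⟩ with hi | ⟨t, ht⟩
      · exact ⟨0, hi.symm⟩
      · exact ⟨t.succ, ht⟩
    choose f hf using hmem
    have hfi : Function.Injective f := fun i j hij => hm (by rw [← hf, ← hf, hij])
    have hfs := Finite.surjective_of_injective hfi
    have key : ∀ j, RainbowMid cv ce u ((Fin.cons w g : Fin (n + 1) → W) j) v := by
      intro j
      obtain ⟨i, rfl⟩ := hfs j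
      rw [hf]
      exact (h i).2.2
    exact ⟨key 0, fun t => key t.succ⟩
  · rintro ⟨h0, h1⟩
    refine ⟨Fin.cons w g, hinj, fun i => ?_⟩
    have hadj := (hcom ((Fin.cons w g : Fin (n + 1) → W) i)).2 (by
      cases i using Fin.cases with
      | zero => exact .inl rfl
      | succ t => exact .inr ⟨t, rfl⟩)
    refine ⟨hadj.1, hadj.2, ?_⟩
    cases i using Fin.cases with
    | zero => exact h0
    | succ t => exact h1 t

section Gadget

variable {E1 E2 : Set (V × V)} {n : ℕ} {G : SimpleGraph V}
  {cv : V ⊕ Gadget V E1 E2 (n + 1) → Fin 3} {ce : Sym2 (V ⊕ Gadget V E1 E2 (n + 1)) → Fin 3}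

theorem pair_inl_iff {cv₀ : V → Fin 3} {ce₀ : Sym2 V → Fin 3} {u v : V} (hne : u ≠ v)
    (hna : ¬G.Adj u v) (hcv : ∀ x, cv (.inl x) = cv₀ x)
    (hce : ∀ x y, ce s(.inl x, .inl y) = ce₀ s(x, y)) :
    TotalRainbowKConnectedPair (gadgetGraph G E1 E2 (n + 1)) cv ce (n + 1) (.inl u) (.inl v) ↔
      TotalRainbowKConnectedPair G cv₀ ce₀ (n + 1) u v := by
  have hadj : ∀ x y : V, (gadgetGraph G E1 E2 (n + 1)).Adj (.inl x) (.inl y) ↔ G.Adj x y := by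
    intro x y
    simp only [gadgetGraph, fromRel_adj, gadgetBigRel, G.adj_comm y x, or_self, ne_eq,
      Sum.inl.injEq]
    exact ⟨And.right, fun h => ⟨h.ne, h⟩⟩
  have hmid : ∀ x, RainbowMid cv ce (.inl u) (.inl x) (.inl v) ↔ RainbowMid cv₀ ce₀ u x v := by
    intro x
    simp only [RainbowMid, hcv, hce]
  rw [totalRainbowKConnectedPair_iff_exists_mid (by simpa using hne) (by simpa [hadj] using hna),
    totalRainbowKConnectedPair_iff_exists_mid hne hna]
  constructor
  · rintro ⟨m, hm, h⟩
    have hinl : ∀ i, ∃ x, m i = .inl x := by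
      intro i
      obtain ⟨h1, h2, -⟩ := h i
      generalize m i = y at h1 h2
      rcases y with x | w
      · exact ⟨x, rfl⟩
      · exfalso
        cases w <;> simp [gadgetGraph, gadgetBigRel, gadgetVRel] at h1 h2 <;>
          exact hne (h1.trans h2.symm)
    choose m₀ hm₀ using hinl
    refine ⟨m₀, fun i j hij => hm (by rw [hm₀, hm₀, hij]), fun i => ?_⟩
    have := h i
    rwa [hm₀, hadj, hadj, hmid] at this
  · rintro ⟨m, hm, h⟩
    refine ⟨fun i => .inl (m i), Sum.inl_injective.comp hm, fun i => ?_⟩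
    rw [hadj, hadj, hmid]
    exact h i

theorem pair_b1_b2_iff (hd : ∀ e ∈ E1, e ∉ E2) :
    TotalRainbowKConnectedPair (gadgetGraph G E1 E2 (n + 1)) cv ce (n + 1)
        (.inr .b1) (.inr .b2) ↔
      RainbowMid cv ce (.inr .b1) (.inr .c) (.inr .b2) ∧
        ∀ t : Fin n, RainbowMid cv ce (.inr .b1) (.inr (.gbb t)) (.inr .b2) := by
  refine totalRainbowKConnectedPair_iff_of_commonNeighbors (Sum.inr Gadget.c)
    (fun t : Fin n => Sum.inr (Gadget.gbb (k := n + 1) t))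
    ?_ ?_ ?_ ?_ ?_
  · simp
  · simp [gadgetGraph, gadgetBigRel, gadgetRel]
  · intro s t
    simp
  · simp
  · rintro (x | x)
    · simp [gadgetGraph, gadgetBigRel, gadgetVRel]
    · cases x <;> simp [gadgetGraph, gadgetBigRel, gadgetRel] <;> grind

theorem pair_b1_cc_iff (e : EHat V E1 E2) (he : e.1 ∈ E1) (j : Fin 2) :
    TotalRainbowKConnectedPair (gadgetGraph G E1 E2 (n + 1)) cv ce (n + 1)
        (.inr .b1) (.inr (.cc e j)) ↔
      RainbowMid cv ce (.inr .b1) (.inr .c) (.inr (.cc e j)) ∧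
        ∀ t : Fin n, RainbowMid cv ce (.inr .b1) (.inr (.gbc e j t)) (.inr (.cc e j)) := by
  refine totalRainbowKConnectedPair_iff_of_commonNeighbors (Sum.inr Gadget.c)
    (fun t : Fin n => Sum.inr (Gadget.gbc (k := n + 1) e j t))
    ?_ ?_ ?_ ?_ ?_
  · simp
  · simp [gadgetGraph, gadgetBigRel, gadgetRel]
  · intro s t
    simp
  · simp
  · rintro (x | x)
    · simp [gadgetGraph, gadgetBigRel, gadgetVRel]
    · cases x <;> simp [gadgetGraph, gadgetBigRel, gadgetRel] <;> grind

theorem pair_b2_cc_iff (e : EHat V E1 E2) (he : e.1 ∈ E2) (j : Fin 2) :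
    TotalRainbowKConnectedPair (gadgetGraph G E1 E2 (n + 1)) cv ce (n + 1)
        (.inr .b2) (.inr (.cc e j)) ↔
      RainbowMid cv ce (.inr .b2) (.inr .c) (.inr (.cc e j)) ∧
        ∀ t : Fin n, RainbowMid cv ce (.inr .b2) (.inr (.gbc e j t)) (.inr (.cc e j)) := by
  refine totalRainbowKConnectedPair_iff_of_commonNeighbors (Sum.inr Gadget.c)
    (fun t : Fin n => Sum.inr (Gadget.gbc (k := n + 1) e j t))
    ?_ ?_ ?_ ?_ ?_
  · simp
  · simp [gadgetGraph, gadgetBigRel, gadgetRel]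
  · intro s t
    simp
  · simp
  · rintro (x | x)
    · simp [gadgetGraph, gadgetBigRel, gadgetVRel]
    · cases x <;> simp [gadgetGraph, gadgetBigRel, gadgetRel] <;> grind

theorem pair_ff_c_iff (e : EHat V E1 E2) (j : Fin 2) :
    TotalRainbowKConnectedPair (gadgetGraph G E1 E2 (n + 1)) cv ce (n + 1)
        (.inr (.ff e j)) (.inr .c) ↔
      RainbowMid cv ce (.inr (.ff e j)) (.inr (.cc e j)) (.inr .c) ∧
        ∀ t : Fin n, RainbowMid cv ce (.inr (.ff e j)) (.inr (.gfc e j t)) (.inr .c) := by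
  refine totalRainbowKConnectedPair_iff_of_commonNeighbors (Sum.inr (Gadget.cc e j))
    (fun t : Fin n => Sum.inr (Gadget.gfc (k := n + 1) e j t))
    ?_ ?_ ?_ ?_ ?_
  · simp
  · simp [gadgetGraph, gadgetBigRel, gadgetRel]
  · intro s t
    simp
  · simp
  · rintro (x | x)
    · simp [gadgetGraph, gadgetBigRel, gadgetVRel]
    · cases x <;> simp [gadgetGraph, gadgetBigRel, gadgetRel] <;> grind

theorem pair_ff_ept_iff (e : EHat V E1 E2) (j : Fin 2) :
    TotalRainbowKConnectedPair (gadgetGraph G E1 E2 (n + 1)) cv ce (n + 1)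
        (.inr (.ff e j)) (.inl (ept e.1 j)) ↔
      RainbowMid cv ce (.inr (.ff e j)) (.inr (.cc e j)) (.inl (ept e.1 j)) ∧
        ∀ t : Fin n,
          RainbowMid cv ce (.inr (.ff e j)) (.inr (.gfe e j t)) (.inl (ept e.1 j)) := by
  refine totalRainbowKConnectedPair_iff_of_commonNeighbors (Sum.inr (Gadget.cc e j))
    (fun t : Fin n => Sum.inr (Gadget.gfe (k := n + 1) e j t))
    ?_ ?_ ?_ ?_ ?_
  · simp
  · simp [gadgetGraph, gadgetBigRel, gadgetVRel]
  · intro s t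
    simp
  · simp
  · rintro (x | x)
    · simp [gadgetGraph, gadgetBigRel, gadgetVRel]
    · cases x <;> simp [gadgetGraph, gadgetBigRel, gadgetRel, gadgetVRel] <;> grind

theorem pair_dd_cc_iff (e : EHat V E1 E2) (j : Fin 2) :
    TotalRainbowKConnectedPair (gadgetGraph G E1 E2 (n + 1)) cv ce (n + 1)
        (.inr (.dd e j)) (.inr (.cc e j)) ↔
      RainbowMid cv ce (.inr (.dd e j)) (.inl (ept e.1 j)) (.inr (.cc e j)) ∧
        ∀ t : Fin n,
          RainbowMid cv ce (.inr (.dd e j)) (.inr (.gdc e j t)) (.inr (.cc e j)) := by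
  refine totalRainbowKConnectedPair_iff_of_commonNeighbors (Sum.inl (ept e.1 j))
    (fun t : Fin n => Sum.inr (Gadget.gdc (k := n + 1) e j t))
    ?_ ?_ ?_ ?_ ?_
  · simp
  · simp [gadgetGraph, gadgetBigRel, gadgetRel]
  · intro s t
    simp
  · simp
  · rintro (x | x)
    · simp [gadgetGraph, gadgetBigRel, gadgetVRel]
    · cases x <;> simp [gadgetGraph, gadgetBigRel, gadgetRel] <;> grind

theorem adj_ept_other (hE : ∀ e ∈ E1 ∪ E2, G.Adj e.1 e.2) (e : EHat V E1 E2) (j : Fin 2) :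
    G.Adj (ept e.1 j) (ept e.1 (Fin2.other j)) := by
  have := hE _ e.2
  fin_cases j
  · simpa [ept, Fin2.other] using this
  · simpa [ept, Fin2.other] using this.symm

theorem pair_dd_ept_iff (hE : ∀ e ∈ E1 ∪ E2, G.Adj e.1 e.2) (e : EHat V E1 E2) (j : Fin 2) :
    TotalRainbowKConnectedPair (gadgetGraph G E1 E2 (n + 1)) cv ce (n + 1)
        (.inr (.dd e j)) (.inl (ept e.1 (Fin2.other j))) ↔
      RainbowMid cv ce (.inr (.dd e j)) (.inl (ept e.1 j)) (.inl (ept e.1 (Fin2.other j))) ∧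
        ∀ t : Fin n, RainbowMid cv ce (.inr (.dd e j)) (.inr (.gde e j t))
          (.inl (ept e.1 (Fin2.other j))) := by
  have hadj := adj_ept_other hE e j
  refine totalRainbowKConnectedPair_iff_of_commonNeighbors (Sum.inl (ept e.1 j))
    (fun t : Fin n => Sum.inr (Gadget.gde (k := n + 1) e j t))
    ?_ ?_ ?_ ?_ ?_
  · simp
  · simpa [gadgetGraph, gadgetBigRel, gadgetRel, gadgetVRel] using hadj.ne'
  · intro s t
    simp
  · simp
  · rintro (x | x)
    · simp [gadgetGraph, gadgetBigRel, gadgetVRel]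
      rintro rfl
      exact ⟨hadj.ne, .inl hadj⟩
    · cases x <;> simp [gadgetGraph, gadgetBigRel, gadgetRel, gadgetVRel] <;> grind

end Gadget

theorem forall_gadgetP_iff {E1 E2 : Set (V × V)} {k : ℕ} {Q : Set (Sym2 V)}
    {p : V ⊕ Gadget V E1 E2 k → V ⊕ Gadget V E1 E2 k → Prop} :
    (∀ x y, gadgetP Q x y → p x y) ↔
      (∀ u v, s(u, v) ∈ Q → p (.inl u) (.inl v)) ∧
      p (.inr .b1) (.inr .b2) ∧
      (∀ e : EHat V E1 E2, e.1 ∈ E1 → ∀ j, p (.inr .b1) (.inr (.cc e j))) ∧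
      (∀ e : EHat V E1 E2, e.1 ∈ E2 → ∀ j, p (.inr .b2) (.inr (.cc e j))) ∧
      (∀ e j, p (.inr (.ff e j)) (.inr .c)) ∧
      (∀ e j, p (.inr (.ff e j)) (.inl (ept e.1 j))) ∧
      (∀ e j, p (.inr (.dd e j)) (.inr (.cc e j))) ∧
      ∀ e j, p (.inr (.dd e j)) (.inl (ept e.1 (Fin2.other j))) := by
  constructor
  · intro h
    exact ⟨fun u v huv => h _ _ huv, h _ _ trivial, fun e he j => h _ _ he,
      fun e he j => h _ _ he, fun e j => h _ _ trivial, fun e j => h _ _ rfl,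
      fun e j => h _ _ ⟨rfl, rfl⟩, fun e j => h _ _ rfl⟩
  · rintro ⟨h1, h2, h3, h4, h5, h6, h7, h8⟩ x y hxy
    unfold gadgetP at hxy
    split at hxy
    · exact h1 _ _ hxy
    · exact h2
    · exact h3 _ hxy _
    · exact h4 _ hxy _
    · exact h5 _ _
    · subst hxy; exact h6 _ _
    · obtain ⟨rfl, rfl⟩ := hxy; exact h7 _ _
    · subst hxy; exact h8 _ _
    · exact hxy.elim

/-- For `x ≠ y`, the element of `Fin 3` different from both. -/
def thirdColor (x y : Fin 3) : Fin 3 := -(x + y)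

theorem thirdColor_ne : ∀ {x y : Fin 3}, x ≠ y → thirdColor x y ≠ x ∧ thirdColor x y ≠ y := by
  decide

/-- The vertex coloring of the gadget graph extending `cv`. -/
def extendVertexColoring {E1 E2 : Set (V × V)} {k : ℕ} (cv : V → Fin 3) (ce : Sym2 V → Fin 3)
    (a b : Fin 3) : V ⊕ Gadget V E1 E2 k → Fin 3
  | .inl v => cv v
  | .inr .c => thirdColor a b
  | .inr (.cc e _) => ce s(e.1.1, e.1.2) + 1
  | .inr _ => 1

/-- An orientation-dependent weight whose symmetrization is the edge coloring of the gadget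
graph: away from pairs of original vertices at most one orientation has a nonzero weight. -/
def extendEdgeWeight {E1 E2 : Set (V × V)} {k : ℕ} (cv : V → Fin 3) (ce : Sym2 V → Fin 3)
    (a b : Fin 3) : V ⊕ Gadget V E1 E2 k → V ⊕ Gadget V E1 E2 k → Fin 3
  | .inl u, .inl v => 2 * ce s(u, v)
  | .inr .b1, .inr .c => b
  | .inr .b2, .inr .c => a
  | .inr .c, .inr (.cc e _) => ce s(e.1.1, e.1.2)
  | .inr (.cc e _), .inl _ => ce s(e.1.1, e.1.2)
  | .inr (.ff e _), .inr (.cc _ _) => ce s(e.1.1, e.1.2) + 2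
  | .inr (.dd e _), .inl v => thirdColor (ce s(e.1.1, e.1.2)) (cv v)
  | .inr .b1, .inr _ => 2
  | .inr .b2, .inr (.gbc _ _ _) => 2
  | .inr (.ff _ _), .inr (.gfc _ _ _) => 2
  | .inr (.ff _ _), .inr (.gfe _ _ _) => 2
  | .inr (.dd _ _), .inr _ => 2
  | _, _ => 0

/-- The edge coloring of the gadget graph extending `ce`. -/
def extendEdgeColoring {E1 E2 : Set (V × V)} {k : ℕ} (cv : V → Fin 3) (ce : Sym2 V → Fin 3)
    (a b : Fin 3) : Sym2 (V ⊕ Gadget V E1 E2 k) → Fin 3 :=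
  Sym2.lift ⟨fun x y => extendEdgeWeight cv ce a b x y + extendEdgeWeight cv ce a b y x,
    fun _ _ => add_comm _ _⟩

theorem ce_ept_other (ce : Sym2 V → Fin 3) (e : V × V) (j : Fin 2) :
    ce s(ept e j, ept e (Fin2.other j)) = ce s(e.1, e.2) := by
  fin_cases j
  · simp [ept, Fin2.other]
  · simp [ept, Fin2.other, Sym2.eq_swap]

/-- (Lemma 2.3: Problem 3 reduces to Problem 2.) The reduction graph `G'`
admits a total coloring with `3` colors making every pair in `P` total rainbow
`k`-connected if and only if `G` admits a total coloring `χ` with `3` colors making every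
pair in `Q` total rainbow `k`-connected, such that all edges of `Ê₁` receive one common
color, all edges of `Ê₂` receive another common color different from it, and
`χ(e) ∉ {χ(e¹), χ(e²)}` for every `e ∈ Ê`. -/
theorem gadgetGraph_iff {V : Type*} (k : ℕ) (hk : 1 ≤ k) (G : SimpleGraph V)
    (hG : G.Connected) (Q : Set (Sym2 V))
    (hQ : ∀ u v : V, s(u, v) ∈ Q → u ≠ v ∧ ¬G.Adj u v)
    (E1 E2 : Set (V × V))
    (hE : ∀ e ∈ E1 ∪ E2, G.Adj e.1 e.2)
    (hdisj : ∀ e ∈ E1, ∀ f ∈ E2, s(e.1, e.2) ≠ s(f.1, f.2))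
    (hrep₁ : ∀ e ∈ E1, ∀ f ∈ E1, s(e.1, e.2) = s(f.1, f.2) → e = f)
    (hrep₂ : ∀ e ∈ E2, ∀ f ∈ E2, s(e.1, e.2) = s(f.1, f.2) → e = f) :
    (∃ (cv' : (V ⊕ Gadget V E1 E2 k) → Fin 3)
        (ce' : Sym2 (V ⊕ Gadget V E1 E2 k) → Fin 3),
        ∀ x y, gadgetP Q x y →
          TotalRainbowKConnectedPair (gadgetGraph G E1 E2 k) cv' ce' k x y) ↔
    (∃ (cv : V → Fin 3) (ce : Sym2 V → Fin 3),
        (∀ u v : V, s(u, v) ∈ Q → TotalRainbowKConnectedPair G cv ce k u v) ∧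
        (∃ a b : Fin 3, a ≠ b ∧ (∀ e ∈ E1, ce s(e.1, e.2) = a) ∧
          (∀ e ∈ E2, ce s(e.1, e.2) = b)) ∧
        (∀ e ∈ E1 ∪ E2, ce s(e.1, e.2) ≠ cv e.1 ∧ ce s(e.1, e.2) ≠ cv e.2)) := by
  obtain ⟨n, rfl⟩ : ∃ n, k = n + 1 := ⟨k - 1, by omega⟩
  have hd : ∀ e ∈ E1, e ∉ E2 := fun e h1 h2 => hdisj e h1 e h2 rfl
  simp only [forall_gadgetP_iff, pair_b1_b2_iff hd, pair_ff_c_iff, pair_ff_ept_iff, pair_dd_cc_iff,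
    pair_dd_ept_iff hE]
  constructor
  · rintro ⟨cv, ce, h1, ⟨h2, -⟩, h3, h4, h5, h6, h7, h8⟩
    have hκ : ∀ (e : EHat V E1 E2) (j : Fin 2),
        ce s(.inr .c, .inr (.cc e j)) = ce s(.inl e.1.1, .inl e.1.2) ∧
          ce s(.inl e.1.1, .inl e.1.2) ≠ cv (.inl (ept e.1 j)) := by
      intro e j
      have g5 := (h5 e j).1
      have g6 := (h6 e j).1
      have g7 := (h7 e j).1
      have g8 := (h8 e j).1
      have hs := ce_ept_other (fun z => ce (z.map Sum.inl)) e.1 j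
      simp only [Sym2.map_mk] at hs
      simp only [RainbowMid] at g5 g6 g7 g8
      rw [hs] at g8
      rw [Sym2.eq_swap (a := Sum.inr (Gadget.cc e j)) (b := Sum.inr Gadget.c)] at g5
      rw [Sym2.eq_swap (a := Sum.inl (ept e.1 j)) (b := Sum.inr (Gadget.cc e j))] at g7
      omega
    refine ⟨fun v => cv (.inl v), fun z => ce (z.map Sum.inl), fun u v huv => ?_,
      ⟨ce s(.inr .b2, .inr .c), ce s(.inr .b1, .inr .c), ?_, fun e he => ?_, fun e he => ?_⟩,
      fun e he => ?_⟩
    · obtain ⟨hne, hna⟩ := hQ u v huv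
      exact (pair_inl_iff hne hna (fun _ => rfl) (fun _ _ => rfl)).1 (h1 u v huv)
    · have := h2.1
      rw [Sym2.eq_swap (a := Sum.inr Gadget.c)] at this
      exact this.symm
    · have g := ((pair_b1_cc_iff ⟨e, .inl he⟩ he 0).1 (h3 ⟨e, .inl he⟩ he 0)).1
      have hk := (hκ ⟨e, .inl he⟩ 0).1
      simp only [RainbowMid, Sym2.map_mk] at g h2 hk ⊢
      rw [Sym2.eq_swap (a := Sum.inr Gadget.c) (b := Sum.inr Gadget.b2)] at h2
      omega
    · have g := ((pair_b2_cc_iff ⟨e, .inr he⟩ he 0).1 (h4 ⟨e, .inr he⟩ he 0)).1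
      have hk := (hκ ⟨e, .inr he⟩ 0).1
      simp only [RainbowMid, Sym2.map_mk] at g h2 hk ⊢
      rw [Sym2.eq_swap (a := Sum.inr Gadget.c) (b := Sum.inr Gadget.b2)] at h2
      omega
    · exact ⟨(hκ ⟨e, he⟩ 0).2, (hκ ⟨e, he⟩ 1).2⟩
  · rintro ⟨cv, ce, h1, ⟨a, b, hab, ha, hb⟩, hv⟩
    have h3 := thirdColor_ne hab
    have hv' : ∀ (e : EHat V E1 E2) (j : Fin 2), ce s(e.1.1, e.1.2) ≠ cv (ept e.1 j) := by
      intro e j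
      fin_cases j
      · exact (hv e.1 e.2).1
      · exact (hv e.1 e.2).2
    refine ⟨extendVertexColoring cv ce a b, extendEdgeColoring cv ce a b, fun u v huv => ?_,
      ⟨?_, fun t => ?_⟩, fun e he j => ?_, fun e he j => ?_, fun e j => ⟨?_, fun t => ?_⟩,
      fun e j => ⟨?_, fun t => ?_⟩, fun e j => ⟨?_, fun t => ?_⟩, fun e j => ⟨?_, fun t => ?_⟩⟩
    · obtain ⟨hne, hna⟩ := hQ u v huv
      refine (pair_inl_iff hne hna (fun _ => rfl) (fun x y => ?_)).2 (h1 u v huv)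
      simp only [extendEdgeColoring, extendEdgeWeight, Sym2.lift_mk, Sym2.eq_swap (a := y)]
      omega
    · simp [RainbowMid, extendEdgeColoring, extendEdgeWeight, extendVertexColoring]
      omega
    · simp [RainbowMid, extendEdgeColoring, extendEdgeWeight, extendVertexColoring]
    · have := ha _ he
      rw [pair_b1_cc_iff e he]
      refine ⟨?_, fun t => ?_⟩
      · simp [RainbowMid, extendEdgeColoring, extendEdgeWeight, extendVertexColoring]
        omega
      · simp [RainbowMid, extendEdgeColoring, extendEdgeWeight, extendVertexColoring]
    · have := hb _ he
      rw [pair_b2_cc_iff e he]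
      refine ⟨?_, fun t => ?_⟩
      · simp [RainbowMid, extendEdgeColoring, extendEdgeWeight, extendVertexColoring]
        omega
      · simp [RainbowMid, extendEdgeColoring, extendEdgeWeight, extendVertexColoring]
    · simp [RainbowMid, extendEdgeColoring, extendEdgeWeight, extendVertexColoring]
    · simp [RainbowMid, extendEdgeColoring, extendEdgeWeight, extendVertexColoring]
    · simp [RainbowMid, extendEdgeColoring, extendEdgeWeight, extendVertexColoring]
    · simp [RainbowMid, extendEdgeColoring, extendEdgeWeight, extendVertexColoring]
    · have := hv' e j
      have ht := thirdColor_ne this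
      simp [RainbowMid, extendEdgeColoring, extendEdgeWeight, extendVertexColoring]
      omega
    · simp [RainbowMid, extendEdgeColoring, extendEdgeWeight, extendVertexColoring]
    · have := hv' e j
      have ht := thirdColor_ne this
      have hs := ce_ept_other ce e.1 j
      simp [RainbowMid, extendEdgeColoring, extendEdgeWeight, extendVertexColoring,
        Sym2.eq_swap (a := ept e.1 (Fin2.other j)), hs]
      omega
    · simp [RainbowMid, extendEdgeColoring, extendEdgeWeight, extendVertexColoring]

end Paper
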